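/- arXiv:2004.09481 — 6 statements merged into one kernel-verified Lean document; each statement's English description precedes it below -/
import Mathlib

section
/- For every real ε > 0 and every γ ∈ (0,1], ln(1 / (1 - (1 - e^{-ε})^γ)) ≤ ε + ln(1/γ). -/
/-- For every real `ε > 0` and every `γ ∈ (0,1]`,
`ln(1 / (1 - (1 - e^{-ε})^γ)) ≤ ε + ln(1/γ)`. -/
theorem stmt_2 (ε γ : ℝ) (hε : 0 < ε) (hγ0 : 0 < γ) (hγ1 : γ ≤ 1) :
    Real.log (1 / (1 - (1 - Real.exp (-ε)) ^ γ)) ≤ ε + Real.log (1 / γ) := by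
  have hexp : Real.exp (-ε) ≤ 1 := Real.exp_le_one_iff.2 (by linarith)
  have hbernoulli : (1 - Real.exp (-ε)) ^ γ ≤ 1 - γ * Real.exp (-ε) := by
    simpa [← sub_eq_add_neg] using
      rpow_one_add_le_one_add_mul_self (neg_le_neg hexp) hγ0.le hγ1
  have hlog : Real.log (γ * Real.exp (-ε)) ≤ Real.log (1 - (1 - Real.exp (-ε)) ^ γ) :=
    Real.log_le_log (by positivity) (by linarith)
  rw [Real.log_mul hγ0.ne' (Real.exp_ne_zero _), Real.log_exp] at hlog
  rw [one_div, one_div, Real.log_inv, Real.log_inv]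
  linarith
end

section
/- For every real ε with 0 < ε ≤ ln 2 and every γ ∈ (0,1], ln(1 / (1 - (1 - e^{-ε})^γ)) ≤ 2·ε^γ / γ. -/
/-- For every real `ε` with `0 < ε ≤ ln 2` and every `γ ∈ (0,1]`,
`ln(1 / (1 - (1 - e^{-ε})^γ)) ≤ 2·ε^γ / γ`, where powers with real exponent
are real powers (`Real.rpow`). -/
theorem stmt_3 (ε γ : ℝ) (hε0 : 0 < ε) (hε1 : ε ≤ Real.log 2)
    (hγ0 : 0 < γ) (hγ1 : γ ≤ 1) :
    Real.log (1 / (1 - (1 - Real.exp (-ε)) ^ γ)) ≤ 2 * ε ^ γ / γ := by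
  have hhalf : 1 / 2 ≤ Real.exp (-ε) := by
    calc (1 / 2 : ℝ) = Real.exp (-Real.log 2) := by
          rw [Real.exp_neg, Real.exp_log two_pos, one_div]
      _ ≤ Real.exp (-ε) := Real.exp_le_exp.mpr (neg_le_neg hε1)
  have hlt : Real.exp (-ε) < 1 := Real.exp_lt_one_iff.mpr (by linarith)
  have hle : 1 - Real.exp (-ε) ≤ ε := by linarith [Real.add_one_le_exp (-ε)]
  have hpε : (1 - Real.exp (-ε)) ^ γ ≤ ε ^ γ :=
    Real.rpow_le_rpow (by linarith) hle hγ0.le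
  have hp0 : 0 ≤ (1 - Real.exp (-ε)) ^ γ := Real.rpow_nonneg (by linarith) γ
  have hbernoulli : (1 - Real.exp (-ε)) ^ γ ≤ 1 + γ * (-1 / 2) :=
    (Real.rpow_le_rpow (by linarith) (by linarith) hγ0.le).trans
      (rpow_one_add_le_one_add_mul_self (s := -1 / 2) (by norm_num) hγ0.le hγ1)
  set y := (1 - Real.exp (-ε)) ^ γ
  have hy : γ / 2 ≤ 1 - y := by linarith
  have hy0 : 0 < 1 - y := by linarith
  calc Real.log (1 / (1 - y)) ≤ 1 / (1 - y) - 1 :=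
        Real.log_le_sub_one_of_pos (by positivity)
    _ = y / (1 - y) := by field_simp; ring
    _ ≤ y / (γ / 2) := by gcongr
    _ = 2 * y / γ := by field_simp
    _ ≤ 2 * ε ^ γ / γ := by gcongr
end

section
/- Let k, n be positive integers with n divisible by 3. Suppose the shuffle protocol P = (R, A) over data domain [k] is (ε, δ, 1/3)-robustly shuffle private and solves the (α, β)-distinct elements problem on input length n. Define the online algorithm Q_P on streams in [k]^{n/3} as follows: its internal state is a finite multiset of messages, initialized as I_0 = the multiset union of n/3 independent draws from R(1); upon reading the i-th stream element x_i it sets I_i = I_{i-1} plus an independent draw of R(x_i); after the stream it forms y = I_{n/3} plus the multiset union of n/3 fresh independent draws from R(1), and outputs A(y). Then Q_P is (ε, δ)-pan-private and solves the (α+1, β)-distinct elements problem on input length n/3. -/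
open scoped ENNReal

/-- Distribution of the multiset union of independent draws from a list of
distributions over finite multisets of messages. -/
noncomputable def pmfUnion {Y : Type*} : List (PMF (Multiset Y)) → PMF (Multiset Y)
  | [] => PMF.pure 0
  | q :: qs => q.bind fun s => (pmfUnion qs).map fun t => s + t

/-- The shuffled execution `(S ∘ R^m)(x)` of a shuffle protocol with randomizer
`R` on the input list `xs`: the multiset union of independent draws
`R x₁, …, R xₘ`. -/
noncomputable def shuffled {α Y : Type*} (R : α → PMF (Multiset Y)) (xs : List α) :
    PMF (Multiset Y) :=
  pmfUnion (xs.map R)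

/-- Two datasets/streams are neighbors if they differ in at most one coordinate. -/
def Neighbor {α : Type*} {m : ℕ} (x x' : Fin m → α) : Prop :=
  ∃ i, ∀ j, j ≠ i → x j = x' j

/-- `(ε, δ)`-differential privacy for a map from inputs to distributions,
with respect to a neighbor relation. -/
def DPFor {I Z : Type*} (M : I → PMF Z) (nb : I → I → Prop) (ε δ : ℝ) : Prop :=
  ∀ x x', nb x x' → ∀ T : Set Z,
    (M x).toOuterMeasure T ≤
      ENNReal.ofReal (Real.exp ε) * (M x').toOuterMeasure T + ENNReal.ofReal δ

/-- `(ε, δ, 1/3)`-robust shuffle privacy on `n` users: for every number `m` of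
honest users with `m ≥ n/3`, the shuffled execution on `m` inputs is
`(ε, δ)`-differentially private. -/
def RobustShufflePrivateThird {k : ℕ} {Y : Type*} (R : Fin k → PMF (Multiset Y))
    (n : ℕ) (ε δ : ℝ) : Prop :=
  ∀ m : ℕ, n ≤ 3 * m →
    DPFor (fun x : Fin m → Fin k => shuffled R (List.ofFn x)) Neighbor ε δ

/-- The number of distinct elements appearing in `x`. -/
noncomputable def distinctCount {k m : ℕ} (x : Fin m → Fin k) : ℕ :=
  (Finset.univ.image x).card

/-- The shuffle protocol `(R, A)` solves the `(α, β)`-distinct elements problem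
on input length `n`. -/
def SolvesDE {k : ℕ} {Y : Type*} (R : Fin k → PMF (Multiset Y))
    (A : Multiset Y → ℝ) (n : ℕ) (α β : ℝ) : Prop :=
  ∀ x : Fin n → Fin k,
    ENNReal.ofReal (1 - β) ≤
      (shuffled R (List.ofFn x)).toOuterMeasure
        {s | |A s - (distinctCount x : ℝ)| ≤ α}

/-- Joint distribution of (internal state at time `t`, final output) of the
online algorithm `Q_P`: the state is initialized with `n3` independent draws of
`R o` (dummy element `o = 1`), each stream element contributes a fresh draw of
`R`, and `n3` more draws of `R o` are added after the stream before running the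
analyzer `A` on the final multiset. -/
noncomputable def QPjointDE {k n3 : ℕ} {Y : Type*} (R : Fin k → PMF (Multiset Y))
    (A : Multiset Y → ℝ) (o : Fin k) (x : Fin n3 → Fin k) (t : ℕ) :
    PMF (Multiset Y × ℝ) :=
  (shuffled R (List.replicate n3 o ++ (List.ofFn x).take t)).bind fun It =>
    (shuffled R ((List.ofFn x).drop t ++ List.replicate n3 o)).map fun rest =>
      (It, A (It + rest))

theorem pmfUnion_append {Y : Type*} (l₁ l₂ : List (PMF (Multiset Y))) :
    pmfUnion (l₁ ++ l₂) =
      (pmfUnion l₁).bind fun s => (pmfUnion l₂).map fun t => s + t := by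
  induction l₁ with
  | nil => simp only [List.nil_append, pmfUnion, PMF.pure_bind, zero_add]; exact (PMF.map_id _).symm
  | cons q l ih =>
    simp only [List.cons_append, pmfUnion, ih, PMF.map_bind, PMF.bind_bind, PMF.bind_map,
      PMF.map_comp, Function.comp_def, add_assoc]

theorem shuffled_append {α Y : Type*} (R : α → PMF (Multiset Y)) (l₁ l₂ : List α) :
    shuffled R (l₁ ++ l₂) =
      (shuffled R l₁).bind fun s => (shuffled R l₂).map fun t => s + t := by
  simp [shuffled, pmfUnion_append]

/-- An approximate multiplicative bound that holds for every value of an independent auxiliary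
random variable also holds for the mixture. -/
theorem toOuterMeasure_bind_le {B Z : Type*} (q : PMF B) (p p' : B → PMF Z) (c d : ℝ≥0∞) (T : Set Z)
    (h : ∀ b, (p b).toOuterMeasure T ≤ c * (p' b).toOuterMeasure T + d) :
    (q.bind p).toOuterMeasure T ≤ c * (q.bind p').toOuterMeasure T + d := by
  simp only [PMF.toOuterMeasure_bind_apply]
  calc ∑' b, q b * (p b).toOuterMeasure T
      ≤ ∑' b, (c * (q b * (p' b).toOuterMeasure T) + q b * d) := by
        refine ENNReal.tsum_le_tsum fun b => (mul_le_mul_right (h b) (q b)).trans_eq ?_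
        ring
    _ = c * ∑' b, q b * (p' b).toOuterMeasure T + d := by
        rw [ENNReal.tsum_add, ENNReal.tsum_mul_left, ENNReal.tsum_mul_right, q.tsum_coe, one_mul]

/-- Approximate indistinguishability is preserved by post-processing that uses independent
randomness. -/
theorem toOuterMeasure_bind_map_le {B S Z : Type*} (q : PMF B) (p p' : PMF S) (f : B → S → Z)
    (c d : ℝ≥0∞) (h : ∀ U : Set S, p.toOuterMeasure U ≤ c * p'.toOuterMeasure U + d) (T : Set Z) :
    (q.bind fun b => p.map (f b)).toOuterMeasure T ≤
      c * (q.bind fun b => p'.map (f b)).toOuterMeasure T + d :=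
  toOuterMeasure_bind_le q _ _ c d T fun b => by
    simpa only [PMF.toOuterMeasure_map_apply] using h (f b ⁻¹' T)

theorem RobustShufflePrivateThird.list_le {k : ℕ} {Y : Type*} {R : Fin k → PMF (Multiset Y)}
    {n : ℕ} {ε δ : ℝ} (h : RobustShufflePrivateThird R n ε δ) {l l' : List (Fin k)}
    (hlen : l.length = l'.length) (hn : n ≤ 3 * l.length) {i : ℕ} (hi : i < l.length)
    (hl : ∀ j, j ≠ i → l[j]? = l'[j]?) (T : Set (Multiset Y)) :
    (shuffled R l).toOuterMeasure T ≤
      ENNReal.ofReal (Real.exp ε) * (shuffled R l').toOuterMeasure T + ENNReal.ofReal δ := by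
  have key := h l.length hn l.get (fun j => l'.get (j.cast hlen))
    ⟨⟨i, hi⟩, fun j hj => by
      have := hl j fun e => hj (Fin.ext e)
      have hj' : (j : ℕ) < l'.length := by omega
      simpa [List.getElem?_eq_getElem hj'] using this⟩ T
  have e : List.ofFn (fun j : Fin l.length => l'.get (j.cast hlen)) = l' :=
    List.ext_getElem (by simp [hlen]) (by simp)
  simpa only [List.ofFn_get, e] using key

theorem SolvesDE.list_le {k : ℕ} {Y : Type*} {R : Fin k → PMF (Multiset Y)}
    {A : Multiset Y → ℝ} {n : ℕ} {α β : ℝ} (h : SolvesDE R A n α β) {l : List (Fin k)}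
    (hl : l.length = n) :
    ENNReal.ofReal (1 - β) ≤
      (shuffled R l).toOuterMeasure {s | |A s - (l.toFinset.card : ℝ)| ≤ α} := by
  subst hl
  have hc : distinctCount l.get = l.toFinset.card := by
    unfold distinctCount
    congr 1
    ext a
    simp [List.mem_iff_get]
  simpa only [List.ofFn_get, hc] using h l.get

theorem map_snd_QPjointDE {k n3 : ℕ} {Y : Type*} (R : Fin k → PMF (Multiset Y))
    (A : Multiset Y → ℝ) (o : Fin k) (x : Fin n3 → Fin k) (t : ℕ) :
    (QPjointDE R A o x t).map Prod.snd =
      (shuffled R (List.replicate n3 o ++ List.ofFn x ++ List.replicate n3 o)).map A := by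
  have hl : List.replicate n3 o ++ List.ofFn x ++ List.replicate n3 o =
      (List.replicate n3 o ++ (List.ofFn x).take t) ++
        ((List.ofFn x).drop t ++ List.replicate n3 o) := by
    conv_lhs => rw [← List.take_append_drop t (List.ofFn x)]
    simp only [List.append_assoc]
  rw [hl, shuffled_append]
  simp only [QPjointDE, PMF.map_bind, PMF.map_comp, Function.comp_def]

theorem abs_sub_distinctCount_le_of_padded {k n3 : ℕ} (o : Fin k) (x : Fin n3 → Fin k) {z α : ℝ}
    (h : |z - ((List.replicate n3 o ++ List.ofFn x ++ List.replicate n3 o).toFinset.card : ℝ)|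
      ≤ α) :
    |z - (distinctCount x : ℝ)| ≤ α + 1 := by
  set D := (List.replicate n3 o ++ List.ofFn x ++ List.replicate n3 o).toFinset with hD
  have hx : Finset.univ.image x ⊆ D := by
    intro a
    simp only [hD, Finset.mem_image, Finset.mem_univ, true_and, List.mem_toFinset,
      List.mem_append, List.mem_ofFn]
    tauto
  have hx' : D ⊆ insert o (Finset.univ.image x) := by
    intro a
    simp only [hD, Finset.mem_insert, Finset.mem_image, Finset.mem_univ, true_and,
      List.mem_toFinset, List.mem_append, List.mem_ofFn, List.mem_replicate]
    tauto
  have h1 : (distinctCount x : ℝ) ≤ D.card := by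
    exact_mod_cast Finset.card_le_card hx
  have h2 : (D.card : ℝ) ≤ distinctCount x + 1 := by
    exact_mod_cast (Finset.card_le_card hx').trans (Finset.card_insert_le _ _)
  rw [abs_le] at h ⊢
  constructor <;> linarith [h.1, h.2]

/-- If the shuffle protocol `P = (R, A)` over data domain `[k]` is
`(ε, δ, 1/3)`-robustly shuffle private and solves the `(α, β)`-distinct elements
problem on input length `n = 3·n3`, then the online algorithm `Q_P` is
`(ε, δ)`-pan-private and solves the `(α+1, β)`-distinct elements problem on
streams of length `n/3 = n3`. -/
theorem stmt_9
    (k n3 : ℕ) (hk : 1 ≤ k) (hn3 : 1 ≤ n3)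
    (Y : Type*) (R : Fin k → PMF (Multiset Y)) (A : Multiset Y → ℝ)
    (ε δ α β : ℝ) (hδ : 0 ≤ δ) (hβ : 0 ≤ β)
    (o : Fin k) (ho : (o : ℕ) = 0)
    (hrobust : RobustShufflePrivateThird R (3 * n3) ε δ)
    (hacc : SolvesDE R A (3 * n3) α β) :
    -- pan-privacy of Q_P
    (∀ x x' : Fin n3 → Fin k, Neighbor x x' → ∀ t ≤ n3,
      ∀ T : Set (Multiset Y × ℝ),
        (QPjointDE R A o x t).toOuterMeasure T ≤
          ENNReal.ofReal (Real.exp ε) * (QPjointDE R A o x' t).toOuterMeasure T +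
            ENNReal.ofReal δ) ∧
    -- accuracy of Q_P: it solves the (α+1, β)-distinct elements problem
    (∀ x : Fin n3 → Fin k,
      ENNReal.ofReal (1 - β) ≤
        ((QPjointDE R A o x n3).map Prod.snd).toOuterMeasure
          {z | |z - (distinctCount x : ℝ)| ≤ α + 1}) := by
  refine ⟨?_, fun x => ?_⟩
  · rintro x x' ⟨i, hi⟩ t ht T
    have hget : ∀ j : ℕ, j ≠ i → (List.ofFn x)[j]? = (List.ofFn x')[j]? := by
      intro j hj
      simp only [List.getElem?_ofFn]
      split_ifs with hjn
      · rw [hi ⟨j, hjn⟩ fun e => hj (congrArg Fin.val e)]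
      · rfl
    by_cases hit : (i : ℕ) < t
    · have hdrop : (List.ofFn x).drop t = (List.ofFn x').drop t := by
        refine List.ext_getElem? fun j => ?_
        rw [List.getElem?_drop, List.getElem?_drop, hget _ (by omega)]
      unfold QPjointDE
      simp only [PMF.map, hdrop]
      rw [PMF.bind_comm, PMF.bind_comm (shuffled R (_ ++ (List.ofFn x').take t))]
      refine toOuterMeasure_bind_map_le _ _ _ (fun rest It => (It, A (It + rest))) _ _
        (hrobust.list_le (i := n3 + i) (by simp) (by simp) (by simp; omega) ?_) T
      intro j hj
      simp only [List.getElem?_append, List.length_replicate, List.getElem?_take]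
      split_ifs with h1 h2
      · rfl
      · exact hget _ (by omega)
      · rfl
    · have htake : (List.ofFn x).take t = (List.ofFn x').take t := by
        refine List.ext_getElem? fun j => ?_
        simp only [List.getElem?_take]
        split_ifs with h1
        · exact hget _ (by omega)
        · rfl
      unfold QPjointDE
      rw [htake]
      refine toOuterMeasure_bind_map_le _ _ _ (fun It rest => (It, A (It + rest))) _ _
        (hrobust.list_le (i := i - t) (by simp) (by simp) (by simp; omega) ?_) T
      intro j hj
      simp only [List.getElem?_append, List.length_drop, List.length_ofFn, List.getElem?_drop]
      split_ifs with h1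
      · exact hget _ (by omega)
      · rfl
  · rw [map_snd_QPjointDE, PMF.toOuterMeasure_map_apply]
    have hlen : (List.replicate n3 o ++ List.ofFn x ++ List.replicate n3 o).length = 3 * n3 := by
      simp only [List.length_append, List.length_replicate, List.length_ofFn]
      omega
    refine (hacc.list_le hlen).trans ?_
    exact MeasureTheory.OuterMeasure.mono _ fun s hs => abs_sub_distinctCount_le_of_padded o x hs
end

section
/- Let ℓ ∈ ℕ, p ∈ (0,1), ε > 0, and δ ∈ (0,1) satisfy ℓ·min(p, 1-p) ≥ 10·((e^ε+1)/(e^ε-1))²·ln(2/δ). Then for all integers a, b with |a - b| ≤ 1 and every set T ⊆ ℤ, P_{η ∼ Binomial(ℓ,p)}(a + η ∈ T) ≤ e^ε · P_{η ∼ Binomial(ℓ,p)}(b + η ∈ T) + δ. Equivalently, for any 1-sensitive integer-valued function f of a dataset (one satisfying |f(x) - f(x')| ≤ 1 for all neighboring datasets x, x'), the mechanism that outputs f(x) + η with η ∼ Binomial(ℓ, p) is (ε, δ)-differentially private. -/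
/-- The point mass at `v` of the binomial distribution with `l` trials and success probability
`p`. -/
noncomputable def binomialMass (l : ℕ) (p : ℝ) (v : ℕ) : ℝ :=
  (l.choose v : ℝ) * p ^ v * (1 - p) ^ (l - v)

lemma binomialMass_nonneg (l : ℕ) {p : ℝ} (hp0 : 0 ≤ p) (hp1 : p ≤ 1) (v : ℕ) :
    0 ≤ binomialMass l p v := by
  have : 0 ≤ 1 - p := sub_nonneg.2 hp1
  unfold binomialMass
  positivity

lemma binomialMass_eq_zero_of_lt {l v : ℕ} (p : ℝ) (h : l < v) : binomialMass l p v = 0 := by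
  simp [binomialMass, Nat.choose_eq_zero_of_lt h]

lemma binomialMass_sub {l v : ℕ} (p : ℝ) (h : v ≤ l) :
    binomialMass l p (l - v) = binomialMass l (1 - p) v := by
  simp only [binomialMass, Nat.choose_symm h, Nat.sub_sub_self h, sub_sub_cancel]
  ring

lemma binomialMass_succ_mul {l v : ℕ} (p : ℝ) (h : v < l) :
    binomialMass l p (v + 1) * ((v + 1) * (1 - p)) = binomialMass l p v * ((l - v) * p) := by
  have hc : (l.choose (v + 1) : ℝ) * (v + 1) = l.choose v * (l - v) := by
    rw [← Nat.cast_sub h.le]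
    exact_mod_cast Nat.choose_succ_right_eq l v
  have hs : l - v = (l - (v + 1)) + 1 := by lia
  simp only [binomialMass]
  rw [hs, pow_succ, pow_succ]
  linear_combination p ^ v * p * (1 - p) ^ (l - (v + 1)) * (1 - p) * hc

lemma sum_binomialMass_mul_exp (l : ℕ) (p θ : ℝ) :
    ∑ v ∈ Finset.range (l + 1), binomialMass l p v * Real.exp (θ * (v - l * p)) =
      (p * Real.exp (θ * (1 - p)) + (1 - p) * Real.exp (-(θ * p))) ^ l := by
  rw [add_pow]
  refine Finset.sum_congr rfl fun v hv => ?_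
  have hv : v ≤ l := Nat.lt_succ_iff.1 (Finset.mem_range.1 hv)
  have he : Real.exp (θ * (v - l * p)) =
      Real.exp (θ * (1 - p)) ^ v * Real.exp (-(θ * p)) ^ (l - v) := by
    rw [← Real.exp_nat_mul, ← Real.exp_nat_mul, ← Real.exp_add, Nat.cast_sub hv]
    ring_nf
  rw [he, mul_pow, mul_pow, binomialMass]
  ring

lemma centered_bernoulli_mgf_le {p θ : ℝ} (hp0 : 0 ≤ p) (hp1 : p ≤ 1) (hθ0 : 0 ≤ θ)
    (hθ1 : θ ≤ 1) :
    p * Real.exp (θ * (1 - p)) + (1 - p) * Real.exp (-(θ * p)) ≤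
      Real.exp (p * (1 - p) * θ ^ 2) := by
  have hq : 0 ≤ 1 - p := sub_nonneg.2 hp1
  have key : ∀ u : ℝ, |u| ≤ 1 → Real.exp u ≤ 1 + u + u ^ 2 := fun u hu => by
    linarith [(abs_le.1 (Real.abs_exp_sub_one_sub_id_le hu)).2]
  have h1 := key (θ * (1 - p)) (by
    rw [abs_of_nonneg (by positivity)]; nlinarith)
  have h2 := key (-(θ * p)) (by
    rw [abs_neg, abs_of_nonneg (by positivity)]; nlinarith)
  calc _ ≤ p * (1 + θ * (1 - p) + (θ * (1 - p)) ^ 2)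
        + (1 - p) * (1 + -(θ * p) + (-(θ * p)) ^ 2) := by gcongr
    _ = p * (1 - p) * θ ^ 2 + 1 := by ring
    _ ≤ _ := Real.add_one_le_exp _

open scoped Classical in
lemma sum_binomialMass_upper_tail_le (l : ℕ) {p θ : ℝ} (hp0 : 0 ≤ p) (hp1 : p ≤ 1)
    (hθ0 : 0 ≤ θ) (hθ1 : θ ≤ 1) (x : ℝ) (B : ℕ → Prop) (hB : ∀ v, B v → x ≤ v - l * p) :
    ∑ v ∈ Finset.range (l + 1), (if B v then binomialMass l p v else 0) ≤
      Real.exp (l * (p * (1 - p)) * θ ^ 2 - θ * x) := by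
  have hq : 0 ≤ 1 - p := sub_nonneg.2 hp1
  calc _ ≤ ∑ v ∈ Finset.range (l + 1),
        Real.exp (-(θ * x)) * (binomialMass l p v * Real.exp (θ * (v - l * p))) := by
        refine Finset.sum_le_sum fun v _ => ?_
        have hw := binomialMass_nonneg l hp0 hp1 v
        split_ifs with h
        · rw [mul_left_comm, ← Real.exp_add]
          refine le_mul_of_one_le_right hw (Real.one_le_exp ?_)
          nlinarith [hB v h]
        · positivity
    _ = Real.exp (-(θ * x)) *
        (p * Real.exp (θ * (1 - p)) + (1 - p) * Real.exp (-(θ * p))) ^ l := by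
        rw [← Finset.mul_sum, sum_binomialMass_mul_exp]
    _ ≤ Real.exp (-(θ * x)) * Real.exp (p * (1 - p) * θ ^ 2) ^ l := by
        gcongr
        exact centered_bernoulli_mgf_le hp0 hp1 hθ0 hθ1
    _ = _ := by
        rw [← Real.exp_nat_mul, ← Real.exp_add]
        ring_nf

open scoped Classical in
lemma sum_binomialMass_large_ratio_le (l : ℕ) {p E δ : ℝ} (hp0 : 0 < p) (hp1 : p < 1)
    (hE : 1 < E) (hδ0 : 0 < δ) (hδ1 : δ < 1)
    (hl : 10 * ((E + 1) / (E - 1)) ^ 2 * Real.log (2 / δ) ≤ l * min p (1 - p)) :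
    ∑ v ∈ Finset.range (l + 1),
      (if E * ((l - v) * p) < (v + 1) * (1 - p) then binomialMass l p v else 0) ≤ δ := by
  obtain ⟨c, hc⟩ : ∃ c, c = (E - 1) / (E + 1) := ⟨_, rfl⟩
  have hq : 0 < 1 - p := sub_pos.2 hp1
  have hE1 : 0 < E - 1 := sub_pos.2 hE
  have hcE : c * (E + 1) = E - 1 := by rw [hc]; field_simp
  have hc0 : 0 < c := by rw [hc]; positivity
  have hc1 : c < 1 := by rw [hc, div_lt_one (by linarith)]; linarith
  have hL : 0.69 < Real.log (2 / δ) := by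
    have := Real.log_two_gt_d9
    have h2 : Real.log 2 ≤ Real.log (2 / δ) :=
      Real.log_le_log two_pos (by rw [le_div_iff₀ hδ0]; linarith)
    linarith
  have hmin : 10 * Real.log (2 / δ) ≤ l * min p (1 - p) * c ^ 2 := by
    have h := mul_le_mul_of_nonneg_right hl (sq_nonneg c)
    have h1 : (E + 1) / (E - 1) * c = 1 := by rw [hc]; field_simp
    calc _ = 10 * Real.log (2 / δ) * ((E + 1) / (E - 1) * c) ^ 2 := by rw [h1]; ring
      _ = _ := by ring
      _ ≤ _ := h
  have hl0 : (0 : ℝ) ≤ l := l.cast_nonneg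
  have hvar : 5 * Real.log (2 / δ) ≤ l * (p * (1 - p)) * c ^ 2 := by
    have : min p (1 - p) ≤ 2 * (p * (1 - p)) := by
      rcases le_total p (1 - p) with h | h
      · rw [min_eq_left h]; nlinarith
      · rw [min_eq_right h]; nlinarith
    have h2 : l * min p (1 - p) * c ^ 2 ≤ l * (2 * (p * (1 - p))) * c ^ 2 := by gcongr
    linarith
  have hlarge : 10 ≤ l * p * (E - 1) := by
    have h1 : l * min p (1 - p) * c ^ 2 ≤ l * p * c ^ 2 := by
      gcongr; exact min_le_left _ _
    have h2 : 2 * c ^ 2 ≤ E - 1 := by nlinarith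
    have h3 : l * p * (2 * c ^ 2) ≤ l * p * (E - 1) := by gcongr
    linarith
  have htail := sum_binomialMass_upper_tail_le l hp0.le hp1.le (θ := 0.45 * c) (by positivity)
    (by linarith) (0.9 * (l * (p * (1 - p)) * c))
    (fun v => E * ((l - v) * p) < (v + 1) * (1 - p)) fun v hv => by
      have hpos : 0 < 1 - p + E * p := by positivity
      have h1 : l * (p * (1 - p)) * (E - 1) - (1 - p) ≤ (v - l * p) * (1 - p + E * p) := by
        linarith
      have h2 : (1 - p) * 10 ≤ (1 - p) * (l * p * (E - 1)) := by gcongr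
      have h3 : c * (1 - p + E * p) ≤ E - 1 := by
        rw [← hcE]
        exact mul_le_mul_of_nonneg_left (by nlinarith) hc0.le
      have h4 : l * (p * (1 - p)) * (c * (1 - p + E * p)) ≤ l * (p * (1 - p)) * (E - 1) := by
        gcongr
      refine le_of_mul_le_mul_right ?_ hpos
      linarith
  refine htail.trans ?_
  calc _ ≤ Real.exp (-Real.log (2 / δ)) := by
        gcongr
        linarith
    _ = δ / 2 := by rw [Real.exp_neg, Real.exp_log (by positivity), inv_div]
    _ ≤ δ := by linarith

open scoped Classical in
lemma sum_binomialMass_shift_le (l : ℕ) {p E δ : ℝ} (hp0 : 0 < p) (hp1 : p < 1)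
    (hE : 1 < E) (hδ0 : 0 < δ) (hδ1 : δ < 1)
    (hl : 10 * ((E + 1) / (E - 1)) ^ 2 * Real.log (2 / δ) ≤ l * min p (1 - p))
    (S : ℕ → Prop) :
    ∑ v ∈ Finset.range (l + 1), (if S (v + 1) then binomialMass l p v else 0) ≤
      E * ∑ v ∈ Finset.range (l + 1), (if S v then binomialMass l p v else 0) + δ := by
  have hE0 : 0 < E := by linarith
  have hq : 0 < 1 - p := sub_pos.2 hp1
  have hw := binomialMass_nonneg l hp0.le hp1.le
  have hg : ∀ v, 0 ≤ if S v then binomialMass l p v else 0 := fun v => by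
    split_ifs
    exacts [hw v, le_rfl]
  have hsucc : ∑ v ∈ Finset.range (l + 1), (if S (v + 1) then binomialMass l p (v + 1) else 0) ≤
      ∑ v ∈ Finset.range (l + 1), (if S v then binomialMass l p v else 0) := by
    have h1 := Finset.sum_range_succ' (fun v => if S v then binomialMass l p v else 0) (l + 1)
    have h2 := Finset.sum_range_succ (fun v => if S v then binomialMass l p v else 0) (l + 1)
    simp only [binomialMass_eq_zero_of_lt p l.lt_succ_self, ite_self, add_zero] at h2
    linarith [hg 0]
  have hpt : ∀ v ∈ Finset.range (l + 1), (if S (v + 1) then binomialMass l p v else 0) ≤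
      E * (if S (v + 1) then binomialMass l p (v + 1) else 0) +
      (if E * ((l - v) * p) < (v + 1) * (1 - p) then binomialMass l p v else 0) := by
    intro v hv
    have hv : v ≤ l := Nat.lt_succ_iff.1 (Finset.mem_range.1 hv)
    by_cases hS : S (v + 1)
    · simp only [hS, if_true]
      split_ifs with hB
      · linarith [mul_nonneg hE0.le (hw (v + 1))]
      · rw [not_lt] at hB
        have hpos : 0 < (v + 1 : ℝ) * (1 - p) := by positivity
        rcases hv.lt_or_eq with hlt | rfl
        · rw [add_zero]
          refine le_of_mul_le_mul_right ?_ hpos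
          rw [mul_assoc, binomialMass_succ_mul p hlt, mul_left_comm E]
          exact mul_le_mul_of_nonneg_left hB (hw v)
        · simp only [sub_self, zero_mul, mul_zero] at hB
          linarith
    · simp only [hS, if_false, mul_zero, zero_add]
      split_ifs
      exacts [hw v, le_rfl]
  calc _ ≤ _ := Finset.sum_le_sum hpt
    _ = _ := by rw [Finset.sum_add_distrib, ← Finset.mul_sum]
    _ ≤ _ := add_le_add (mul_le_mul_of_nonneg_left hsucc hE0.le)
      (sum_binomialMass_large_ratio_le l hp0 hp1 hE hδ0 hδ1 hl)

open scoped Classical in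
lemma sum_binomialMass_reflect (l : ℕ) (p : ℝ) (S : ℤ → Prop) :
    ∑ v ∈ Finset.range (l + 1), (if S v then binomialMass l p v else 0) =
      ∑ v ∈ Finset.range (l + 1), (if S (l - v) then binomialMass l (1 - p) v else 0) := by
  rw [← Finset.sum_range_reflect]
  refine Finset.sum_congr rfl fun v hv => ?_
  have hv : v ≤ l := Nat.lt_succ_iff.1 (Finset.mem_range.1 hv)
  rw [Nat.add_sub_cancel, binomialMass_sub p hv, Nat.cast_sub hv]


open scoped Classical in
/-- Binomial mechanism: if `ℓ·min(p, 1-p) ≥ 10·((e^ε+1)/(e^ε-1))²·ln(2/δ)`,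
then for all integers `a, b` with `|a - b| ≤ 1` and every `T ⊆ ℤ`,
`P_{η ∼ Binomial(ℓ,p)}(a + η ∈ T) ≤ e^ε · P_{η ∼ Binomial(ℓ,p)}(b + η ∈ T) + δ`;
i.e. adding `Binomial(ℓ, p)` noise to a 1-sensitive integer-valued function is
`(ε, δ)`-differentially private. -/
theorem stmt_13
    (l : ℕ) (p ε δ : ℝ) (hp0 : 0 < p) (hp1 : p < 1)
    (hε : 0 < ε) (hδ0 : 0 < δ) (hδ1 : δ < 1)
    (hl : 10 * ((Real.exp ε + 1) / (Real.exp ε - 1)) ^ 2 * Real.log (2 / δ)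
      ≤ (l : ℝ) * min p (1 - p))
    (a b : ℤ) (hab : |a - b| ≤ 1) (T : Set ℤ) :
    (∑ v ∈ Finset.range (l + 1),
        if (a + v : ℤ) ∈ T then (l.choose v : ℝ) * p ^ v * (1 - p) ^ (l - v) else 0)
      ≤ Real.exp ε *
        (∑ v ∈ Finset.range (l + 1),
          if (b + v : ℤ) ∈ T then (l.choose v : ℝ) * p ^ v * (1 - p) ^ (l - v) else 0)
        + δ := by
  have hE : 1 < Real.exp ε := Real.one_lt_exp_iff.2 hε
  change (∑ v ∈ Finset.range (l + 1), if (a + v : ℤ) ∈ T then binomialMass l p v else 0) ≤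
    Real.exp ε * (∑ v ∈ Finset.range (l + 1), if (b + v : ℤ) ∈ T then binomialMass l p v else 0) + δ
  obtain rfl | rfl | rfl : a = b ∨ a = b + 1 ∨ a = b - 1 := by
    rw [abs_le] at hab
    lia
  · have hnn : 0 ≤ ∑ v ∈ Finset.range (l + 1),
        if (a + v : ℤ) ∈ T then binomialMass l p v else 0 :=
      Finset.sum_nonneg fun v _ => by
        split_ifs
        exacts [binomialMass_nonneg l hp0.le hp1.le v, le_rfl]
    linarith [le_mul_of_one_le_left hnn hE.le]
  · have h := sum_binomialMass_shift_le l hp0 hp1 hE hδ0 hδ1 hl fun v => (b + v : ℤ) ∈ T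
    simp only [Nat.cast_add, Nat.cast_one] at h
    simpa only [add_assoc, add_comm (1 : ℤ)] using h
  · have hl' : 10 * ((Real.exp ε + 1) / (Real.exp ε - 1)) ^ 2 * Real.log (2 / δ) ≤
        l * min (1 - p) (1 - (1 - p)) := by
      rwa [sub_sub_cancel, min_comm]
    have h := sum_binomialMass_shift_le l (sub_pos.2 hp1) (by linarith) hE hδ0 hδ1 hl'
      fun v => (b + (l - v) : ℤ) ∈ T
    rw [sum_binomialMass_reflect l p fun v => b - 1 + v ∈ T,
      sum_binomialMass_reflect l p fun v => b + v ∈ T]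
    have hs : ∀ v : ℕ, b - 1 + ((l : ℤ) - v) = b + (l - ((v + 1 : ℕ) : ℤ)) := fun v => by
      push_cast
      ring
    simpa only [hs] using h
end

section
/- Let λ > 0 and let X be a random variable with the Poisson distribution of mean λ. Then for every t > 0, P(|X - λ| ≥ t) ≤ 2·exp(-t²/(2(λ + t))). -/
open scoped ENNReal

/-- Chernoff bound for the Poisson distribution, with exponential weight `s` of either sign. -/
theorem poisson_toOuterMeasure_le_exp
    {lam : ℝ} (hlam : 0 ≤ lam) {p : PMF ℕ}
    (hp : ∀ v : ℕ, p v = ENNReal.ofReal (Real.exp (-lam) * lam ^ v / v.factorial))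
    (s c : ℝ) :
    p.toOuterMeasure {v : ℕ | c ≤ s * v} ≤
      ENNReal.ofReal (Real.exp (lam * (Real.exp s - 1) - c)) := by
  have h_sum : HasSum (fun v : ℕ => Real.exp (-lam - c) * ((lam * Real.exp s) ^ v / v.factorial))
      (Real.exp (lam * (Real.exp s - 1) - c)) := by
    convert! (NormedSpace.expSeries_div_hasSum_exp (lam * Real.exp s)).mul_left
      (Real.exp (-lam - c)) using 1
    rw [← Real.exp_eq_exp_ℝ, ← Real.exp_add]
    ring_nf
  rw [PMF.toOuterMeasure_apply, ← h_sum.tsum_eq,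
    ENNReal.ofReal_tsum_of_nonneg (fun v => by positivity) h_sum.summable]
  refine ENNReal.tsum_le_tsum fun v => Set.indicator_apply_le' (fun hv => ?_) fun _ => zero_le
  rw [hp]
  refine ENNReal.ofReal_le_ofReal ?_
  have h_weight : Real.exp (-lam - c) * ((lam * Real.exp s) ^ v / v.factorial) =
      Real.exp (-lam) * lam ^ v / v.factorial * Real.exp (s * v - c) := by
    rw [mul_pow, ← Real.exp_nat_mul, sub_eq_add_neg, sub_eq_add_neg, Real.exp_add, Real.exp_add,
      mul_comm s]
    ring
  rw [h_weight]
  exact le_mul_of_one_le_right (by positivity) (Real.one_le_exp (sub_nonneg.2 hv))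

theorem Real.exp_neg_le_quadratic {s : ℝ} (hs : 0 ≤ s) :
    Real.exp (-s) ≤ 1 - s + s ^ 2 / 2 := by
  rw [Real.exp_neg, inv_le_iff_one_le_mul₀ (Real.exp_pos s)]
  have h_pos : 0 ≤ 1 - s + s ^ 2 / 2 := by nlinarith [sq_nonneg (s - 1)]
  nlinarith [mul_le_mul_of_nonneg_left (Real.quadratic_le_exp_of_nonneg hs) h_pos,
    sq_nonneg (s ^ 2)]

theorem poisson_upper_tail
    {lam : ℝ} (hlam : 0 < lam) {p : PMF ℕ}
    (hp : ∀ v : ℕ, p v = ENNReal.ofReal (Real.exp (-lam) * lam ^ v / v.factorial))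
    {t : ℝ} (ht : 0 ≤ t) :
    p.toOuterMeasure {v : ℕ | lam + t ≤ v} ≤
      ENNReal.ofReal (Real.exp (-(t ^ 2) / (2 * (lam + t)))) := by
  have hu : 0 ≤ t / lam := by positivity
  have h_log := Real.le_log_one_add_of_nonneg hu
  have h_log_nonneg : 0 ≤ Real.log (1 + t / lam) := Real.log_nonneg (by linarith)
  refine (p.toOuterMeasure.mono fun v hv => ?_).trans
    ((poisson_toOuterMeasure_le_exp hlam.le hp (Real.log (1 + t / lam))
      (Real.log (1 + t / lam) * (lam + t))).trans (ENNReal.ofReal_le_ofReal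
        (Real.exp_le_exp.2 ?_)))
  · exact mul_le_mul_of_nonneg_left hv h_log_nonneg
  rw [Real.exp_log (by positivity)]
  have h_mul := mul_le_mul_of_nonneg_right h_log (by positivity : 0 ≤ lam + t)
  have h_eq : lam * (1 + t / lam - 1) - 2 * (t / lam) / (t / lam + 2) * (lam + t) =
      -(t ^ 2 / (t + 2 * lam)) := by
    field_simp
    ring
  have h_div : t ^ 2 / (2 * (lam + t)) ≤ t ^ 2 / (t + 2 * lam) := by
    gcongr
    linarith
  rw [neg_div]
  linarith

theorem poisson_lower_tail
    {lam : ℝ} (hlam : 0 < lam) {p : PMF ℕ}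
    (hp : ∀ v : ℕ, p v = ENNReal.ofReal (Real.exp (-lam) * lam ^ v / v.factorial))
    {t : ℝ} (ht : 0 ≤ t) :
    p.toOuterMeasure {v : ℕ | (v : ℝ) ≤ lam - t} ≤
      ENNReal.ofReal (Real.exp (-(t ^ 2) / (2 * lam))) := by
  have hu : 0 ≤ t / lam := by positivity
  refine (p.toOuterMeasure.mono fun v hv => ?_).trans
    ((poisson_toOuterMeasure_le_exp hlam.le hp (-(t / lam))
      (-(t / lam) * (lam - t))).trans (ENNReal.ofReal_le_ofReal (Real.exp_le_exp.2 ?_)))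
  · exact mul_le_mul_of_nonpos_left hv (neg_nonpos.2 hu)
  have h_exp := mul_le_mul_of_nonneg_left (Real.exp_neg_le_quadratic hu) hlam.le
  have h_eq : lam * (1 - t / lam + (t / lam) ^ 2 / 2) - lam - -(t / lam) * (lam - t) =
      -(t ^ 2) / (2 * lam) := by
    field_simp
    ring
  linarith

/-- Poisson tail bound: if `X ∼ Poisson(λ)` with `λ > 0`, then for every
`t > 0`, `P(|X - λ| ≥ t) ≤ 2·exp(-t²/(2(λ + t)))`. -/
theorem stmt_15
    (lam : ℝ) (hlam : 0 < lam)
    (p : PMF ℕ)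
    (hp : ∀ v : ℕ, p v = ENNReal.ofReal (Real.exp (-lam) * lam ^ v / v.factorial))
    (t : ℝ) (ht : 0 < t) :
    p.toOuterMeasure {v : ℕ | t ≤ |(v : ℝ) - lam|} ≤
      ENNReal.ofReal (2 * Real.exp (-(t ^ 2) / (2 * (lam + t)))) := by
  have h_subset : {v : ℕ | t ≤ |(v : ℝ) - lam|} ⊆
      {v : ℕ | lam + t ≤ v} ∪ {v : ℕ | (v : ℝ) ≤ lam - t} := by
    intro v hv
    rcases le_abs.1 (Set.mem_ofPred.1 hv) with h | h
    · exact Or.inl (Set.mem_ofPred.2 (by linarith))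
    · exact Or.inr (Set.mem_ofPred.2 (by linarith))
  have h_exp : Real.exp (-(t ^ 2) / (2 * lam)) ≤ Real.exp (-(t ^ 2) / (2 * (lam + t))) := by
    rw [neg_div, neg_div]
    gcongr
    linarith
  rw [two_mul (Real.exp _), ENNReal.ofReal_add (by positivity) (by positivity)]
  exact (p.toOuterMeasure.mono h_subset).trans <|
    (MeasureTheory.measure_union_le _ _).trans <|
      add_le_add (poisson_upper_tail hlam hp ht.le)
        ((poisson_lower_tail hlam hp ht.le).trans (ENNReal.ofReal_le_ofReal h_exp))
end

section
/- Let ε > 0, γ ∈ (0,1], δ ∈ (0,1), and let n be a positive integer with n ≥ 20·((e^ε+1)/(e^ε-1))²·ln(2/δ). Set p = 1 - (10/n)·((e^ε+1)/(e^ε-1))²·ln(2/δ), so p ∈ [1/2, 1). Then for every integer m with γn ≤ m ≤ n, the mechanism that on input x ∈ {0,1}^m samples η ∼ Binomial(m, p) and outputs Σ_{i=1}^m x_i + η is (ε, 2·(δ/2)^γ)-differentially private: for all x, x' ∈ {0,1}^m differing in one coordinate and every T ⊆ ℤ, P(Σx_i + η ∈ T) ≤ e^ε·P(Σx'_i + η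 ∈ T) + 2·(δ/2)^γ. -/
open scoped Classical

/-- The probability that a binomial variable with `m` trials and success probability `p`
takes the value `v`. -/
noncomputable def binomialWeight (m : ℕ) (p : ℝ) (v : ℕ) : ℝ :=
  (m.choose v : ℝ) * p ^ v * (1 - p) ^ (m - v)

lemma binomialWeight_nonneg {p : ℝ} (hp0 : 0 ≤ p) (hp1 : p ≤ 1) (m v : ℕ) :
    0 ≤ binomialWeight m p v := by
  have : 0 ≤ 1 - p := sub_nonneg.2 hp1
  unfold binomialWeight
  positivity

lemma sum_binomialWeight (m : ℕ) (p : ℝ) :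
    ∑ v ∈ Finset.range (m + 1), binomialWeight m p v = 1 := by
  have h := add_pow p (1 - p) m
  rw [add_sub_cancel, one_pow] at h
  rw [h]
  exact Finset.sum_congr rfl fun v _ => by unfold binomialWeight; ring

lemma binomialWeight_self_succ (m : ℕ) (p : ℝ) : binomialWeight m p (m + 1) = 0 := by
  simp [binomialWeight]

/-- The ratio of consecutive binomial weights, with denominators cleared. -/
lemma binomialWeight_succ_mul {m v : ℕ} (hv : v ≤ m) (p : ℝ) :
    binomialWeight m p (v + 1) * ((v + 1) * (1 - p)) =
      binomialWeight m p v * ((m - v) * p) := by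
  rcases hv.eq_or_lt with rfl | hv
  · simp [binomialWeight]
  have hc := congrArg (Nat.cast (R := ℝ)) (Nat.choose_succ_right_eq m v)
  push_cast [hv.le] at hc
  obtain ⟨k, rfl⟩ := Nat.exists_eq_add_of_lt hv
  unfold binomialWeight
  rw [show v + k + 1 - (v + 1) = k by omega, show v + k + 1 - v = k + 1 by omega]
  push_cast at hc ⊢
  linear_combination (p ^ (v + 1) * (1 - p) ^ (k + 1)) * hc

/-- The moment generating function of the number of failures. -/
lemma sum_binomialWeight_mul_exp (m : ℕ) (p l : ℝ) :
    ∑ v ∈ Finset.range (m + 1), binomialWeight m p v * Real.exp (l * ((m : ℝ) - v)) =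
      (p + (1 - p) * Real.exp l) ^ m := by
  rw [add_pow]
  refine Finset.sum_congr rfl fun v hv => ?_
  have hv : v ≤ m := Nat.lt_succ_iff.1 (Finset.mem_range.1 hv)
  rw [← Nat.cast_sub hv, mul_comm l, Real.exp_nat_mul, mul_pow, binomialWeight]
  ring

/-- Chernoff bound for either tail, according to the sign of `l`, of the number of failures. -/
lemma sum_binomialWeight_tail_le {m : ℕ} {p l : ℝ} (hp0 : 0 ≤ p) (hp1 : p ≤ 1) (hl : |l| ≤ 1)
    (B : ℕ → Prop)
    (hB : ∀ v ≤ m, B v →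
      2 * l ^ 2 * (m * (1 - p)) ≤ l * (((m : ℝ) - v) - m * (1 - p))) :
    ∑ v ∈ Finset.range (m + 1), (if B v then binomialWeight m p v else 0) ≤
      Real.exp (-(m * (1 - p) * l ^ 2)) := by
  set μ : ℝ := m * (1 - p) with hμ
  have hq : 0 ≤ 1 - p := sub_nonneg.2 hp1
  have hμ0 : 0 ≤ μ := by positivity
  have hmgf : (p + (1 - p) * Real.exp l) ^ m ≤ Real.exp (μ * (l + l ^ 2)) := by
    have hexp : Real.exp l ≤ 1 + l + l ^ 2 := by
      have := (abs_le.1 (Real.abs_exp_sub_one_sub_id_le hl)).2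
      linarith
    calc (p + (1 - p) * Real.exp l) ^ m
        ≤ Real.exp ((1 - p) * (l + l ^ 2)) ^ m := by
          gcongr
          have h1 := Real.add_one_le_exp ((1 - p) * (l + l ^ 2))
          nlinarith [mul_le_mul_of_nonneg_left hexp hq]
      _ = Real.exp (μ * (l + l ^ 2)) := by
          rw [← Real.exp_nat_mul, hμ, mul_assoc]
  calc ∑ v ∈ Finset.range (m + 1), (if B v then binomialWeight m p v else 0)
      ≤ ∑ v ∈ Finset.range (m + 1), binomialWeight m p v * Real.exp (l * ((m : ℝ) - v)) *
          Real.exp (-(l * μ + 2 * l ^ 2 * μ)) := by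
        refine Finset.sum_le_sum fun v hv => ?_
        have hv : v ≤ m := Nat.lt_succ_iff.1 (Finset.mem_range.1 hv)
        have h0 := binomialWeight_nonneg hp0 hp1 m v
        split_ifs with hb
        · rw [mul_assoc, ← Real.exp_add]
          refine le_mul_of_one_le_right h0 (Real.one_le_exp ?_)
          linarith [hB v hv hb]
        · positivity
    _ ≤ Real.exp (μ * (l + l ^ 2)) * Real.exp (-(l * μ + 2 * l ^ 2 * μ)) := by
        rw [← Finset.sum_mul, sum_binomialWeight_mul_exp]
        gcongr
    _ = Real.exp (-(μ * l ^ 2)) := by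
        rw [← Real.exp_add]
        congr 1
        ring

/-- Bounded growth of `f` off a set of small mass compares the mass of a set with that of its
shift. -/
lemma sum_ite_shift_right_le {m : ℕ} {a d : ℝ} (ha : 0 ≤ a) {f : ℕ → ℝ} (hf : ∀ v, 0 ≤ f v)
    (hfm : f (m + 1) = 0) (S : ℕ → Prop)
    (htail : ∑ v ∈ Finset.range (m + 1), (if a * f (v + 1) < f v then f v else 0) ≤ d) :
    ∑ v ∈ Finset.range (m + 1), (if S (v + 1) then f v else 0) ≤
      a * ∑ v ∈ Finset.range (m + 1), (if S v then f v else 0) + d := by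
  have hshift : ∑ v ∈ Finset.range (m + 1), (if S (v + 1) then f (v + 1) else 0) ≤
      ∑ v ∈ Finset.range (m + 1), (if S v then f v else 0) := by
    have h1 := Finset.sum_range_succ' (fun v => if S v then f v else 0) (m + 1)
    have h2 := Finset.sum_range_succ (fun v => if S v then f v else 0) (m + 1)
    have h3 : 0 ≤ if S 0 then f 0 else 0 := by split_ifs <;> simp [hf]
    simp only [hfm, ite_self] at h2
    linarith
  calc ∑ v ∈ Finset.range (m + 1), (if S (v + 1) then f v else 0)
      ≤ ∑ v ∈ Finset.range (m + 1), (a * (if S (v + 1) then f (v + 1) else 0) +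
          if a * f (v + 1) < f v then f v else 0) := by
        refine Finset.sum_le_sum fun v _ => ?_
        have h0 := hf v
        have h1 := mul_nonneg ha (hf (v + 1))
        split_ifs <;> linarith
    _ ≤ _ := by
        rw [Finset.sum_add_distrib, ← Finset.mul_sum]
        gcongr

lemma sum_ite_shift_left_le {m : ℕ} {a d : ℝ} (ha : 0 ≤ a) {f : ℕ → ℝ} (hf : ∀ v, 0 ≤ f v)
    (S : ℕ → Prop)
    (htail : ∑ v ∈ Finset.range (m + 1),
      (if v = 0 ∨ a * f (v - 1) < f v then f v else 0) ≤ d) :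
    ∑ v ∈ Finset.range (m + 1), (if S v then f v else 0) ≤
      a * ∑ v ∈ Finset.range (m + 1), (if S (v + 1) then f v else 0) + d := by
  have hterm : ∀ v, 0 ≤ if S (v + 1) then f v else 0 := fun v => by split_ifs <;> simp [hf]
  refine le_trans ?_ (add_le_add_right htail _)
  rw [Finset.sum_range_succ', Finset.sum_range_succ' (fun v => if v = 0 ∨ _ then f v else 0),
    Finset.sum_range_succ (fun v => if S (v + 1) then f v else 0), ← add_assoc, mul_add]
  have h0 : (if S 0 then f 0 else 0) ≤ if (0 = 0 ∨ a * f (0 - 1) < f 0) then f 0 else 0 := by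
    have := hf 0
    split_ifs <;> simp_all
  refine add_le_add ?_ h0
  have hm := mul_nonneg ha (hterm m)
  suffices ∑ v ∈ Finset.range m, (if S (v + 1) then f (v + 1) else 0) ≤
      ∑ v ∈ Finset.range m, (a * (if S (v + 1) then f v else 0) +
        if v + 1 = 0 ∨ a * f (v + 1 - 1) < f (v + 1) then f (v + 1) else 0) by
    rw [Finset.sum_add_distrib, ← Finset.mul_sum] at this
    linarith
  refine Finset.sum_le_sum fun v _ => ?_
  have h0 := hf (v + 1)
  have h1 := mul_nonneg ha (hf v)
  simp only [Nat.add_sub_cancel, Nat.succ_ne_zero, false_or]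
  split_ifs <;> linarith

/-- The weights drop by more than the factor `a` only in the lower tail of the
number of failures. -/
lemma sum_binomialWeight_succ_drop_le {m : ℕ} {a p k : ℝ} (ha : 1 < a) (hp0 : 1 / 2 ≤ p)
    (hp1 : p < 1) (hk : k * (a + 1) = a - 1) (hμ : 4 ≤ k * (m * (1 - p))) :
    ∑ v ∈ Finset.range (m + 1), (if a * binomialWeight m p (v + 1) < binomialWeight m p v
      then binomialWeight m p v else 0) ≤
      Real.exp (-(m * (1 - p) * (9 / 64 * k ^ 2))) := by
  have hk0 : 0 < k := by
    by_contra! h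
    nlinarith
  have hk1 : k < 1 := by
    by_contra! h
    nlinarith
  have htail := sum_binomialWeight_tail_le (m := m) (l := -(3 / 8 * k)) (by linarith) hp1.le
    (by rw [abs_neg, abs_of_pos (by linarith)]; linarith)
    (fun v => a * binomialWeight m p (v + 1) < binomialWeight m p v) ?_
  · convert htail using 3
    ring
  intro v hv hlt
  have hw := binomialWeight_succ_mul hv p
  have hvm : (v : ℝ) ≤ m := by exact_mod_cast hv
  have hd : 0 < ((v : ℝ) + 1) * (1 - p) := mul_pos (by positivity) (by linarith)
  have hpos : 0 < binomialWeight m p v :=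
    lt_of_le_of_lt (mul_nonneg (by linarith)
      (binomialWeight_nonneg (by linarith) hp1.le m (v + 1))) hlt
  have hratio : a * ((m - v) * p) < (v + 1) * (1 - p) := by
    refine lt_of_mul_lt_mul_left ?_ hpos.le
    have := mul_lt_mul_of_pos_right hlt hd
    linear_combination this - a * hw
  set μ : ℝ := m * (1 - p)
  set w : ℝ := m - v
  have h1 : w * ((1 - p) + a * p) < μ + (1 - p) := by
    have : μ = m * (1 - p) := rfl
    rw [this]
    linear_combination hratio
  have hw0 : 0 ≤ w := sub_nonneg.2 hvm
  have h2 : w * ((a + 1) / 2) < μ + 1 / 2 := by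
    have : (a + 1) / 2 ≤ (1 - p) + a * p := by nlinarith
    linarith [mul_le_mul_of_nonneg_left this hw0]
  have h3 : w ≤ (1 - k) * (μ + 1 / 2) := by
    have e : (1 - k) * ((a + 1) / 2) = 1 := by linear_combination (-1 / 2) * hk
    calc w = (1 - k) * (w * ((a + 1) / 2)) := by linear_combination (-w) * e
      _ ≤ _ := mul_le_mul_of_nonneg_left h2.le (by linarith)
  have h4 : 3 / 4 * k * μ ≤ μ - w := by nlinarith
  nlinarith [mul_le_mul_of_nonneg_left h4 hk0.le]

/-- The weights grow by more than the factor `a` only in the upper tail of the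
number of failures. -/
lemma sum_binomialWeight_pred_rise_le {m : ℕ} {a p k : ℝ} (ha : 1 < a) (hp0 : 1 / 2 ≤ p)
    (hp1 : p < 1) (hk : k * (a + 1) = a - 1) (hμ : 4 ≤ k * (m * (1 - p))) :
    ∑ v ∈ Finset.range (m + 1),
      (if v = 0 ∨ a * binomialWeight m p (v - 1) < binomialWeight m p v
      then binomialWeight m p v else 0) ≤
      Real.exp (-(m * (1 - p) * (9 / 64 * k ^ 2))) := by
  have hk0 : 0 < k := by
    by_contra! h
    nlinarith
  have hk1 : k < 1 := by
    by_contra! h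
    nlinarith
  have htail := sum_binomialWeight_tail_le (m := m) (l := 3 / 8 * k) (by linarith) hp1.le
    (by rw [abs_of_pos (by linarith)]; linarith)
    (fun v => v = 0 ∨ a * binomialWeight m p (v - 1) < binomialWeight m p v) ?_
  · convert htail using 3
    ring
  intro v hv hlt
  have hvm : (v : ℝ) ≤ m := by exact_mod_cast hv
  have hratio : a * (v * (1 - p)) < ((m - v) + 1) * p := by
    rcases v with _ | v
    · simp only [Nat.cast_zero, zero_mul, mul_zero, sub_zero]
      have : 0 < p := by linarith
      positivity
    · simp only [Nat.succ_ne_zero, false_or, Nat.add_sub_cancel] at hlt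
      have hw := binomialWeight_succ_mul (show v ≤ m by omega) p
      have hf := binomialWeight_nonneg (by linarith) hp1.le m v
      have hd : 0 < ((v : ℝ) + 1) * (1 - p) := mul_pos (by positivity) (by linarith)
      push_cast
      refine lt_of_mul_lt_mul_left ?_ hf
      have := mul_lt_mul_of_pos_right hlt hd
      linear_combination this + hw
  set μ : ℝ := m * (1 - p)
  set w : ℝ := m - v with hwdef
  have hw0 : 0 ≤ w := sub_nonneg.2 hvm
  have h1 : a * μ ≤ (w + 1) * (p + a * (1 - p)) := by
    have : (v : ℝ) = m - w := by rw [hwdef]; ring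
    rw [this] at hratio
    have : 0 ≤ a * (1 - p) := mul_nonneg (by linarith) (by linarith)
    linear_combination hratio + this
  have h2 : a * μ ≤ (w + 1) * ((a + 1) / 2) := by
    have : p + a * (1 - p) ≤ (a + 1) / 2 := by nlinarith
    linarith [mul_le_mul_of_nonneg_left this (show 0 ≤ w + 1 by linarith)]
  have h3 : (1 + k) * μ ≤ w + 1 := by
    have e : (1 - k) * ((a + 1) / 2) = 1 := by linear_combination (-1 / 2) * hk
    have e' : (1 - k) * a = 1 + k := by linear_combination -hk
    calc (1 + k) * μ = (1 - k) * (a * μ) := by linear_combination (-μ) * e'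
      _ ≤ (1 - k) * ((w + 1) * ((a + 1) / 2)) :=
        mul_le_mul_of_nonneg_left h2 (by linarith)
      _ = w + 1 := by linear_combination (w + 1) * e
  have h4 : 3 / 4 * k * μ ≤ w - μ := by nlinarith
  nlinarith [mul_le_mul_of_nonneg_left h4 hk0.le]

/-- Changing one bit changes the sum by at most one. -/
lemma sum_bits_neighbours {m : ℕ} {x x' : Fin m → Fin 2}
    (h : ∃ i, ∀ j, j ≠ i → x j = x' j) :
    (∑ i, (x i : ℕ)) = ∑ i, (x' i : ℕ) ∨ (∑ i, (x i : ℕ)) = (∑ i, (x' i : ℕ)) + 1 ∨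
      (∑ i, (x' i : ℕ)) = (∑ i, (x i : ℕ)) + 1 := by
  obtain ⟨i, hi⟩ := h
  have hx := Finset.add_sum_erase Finset.univ (fun j => (x j : ℕ)) (Finset.mem_univ i)
  have hx' := Finset.add_sum_erase Finset.univ (fun j => (x' j : ℕ)) (Finset.mem_univ i)
  have he : ∑ j ∈ Finset.univ.erase i, (x j : ℕ) = ∑ j ∈ Finset.univ.erase i, (x' j : ℕ) :=
    Finset.sum_congr rfl fun j hj => by rw [hi j (Finset.ne_of_mem_erase hj)]
  have := (x i).isLt
  have := (x' i).isLt
  omega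


/-- Robustness of the Balcer–Cheu binary-sum protocol.  Let `ε > 0`,
`γ ∈ (0,1]`, `δ ∈ (0,1)`, and `n ≥ 20·((e^ε+1)/(e^ε-1))²·ln(2/δ)`, and set
`p = 1 - (10/n)·((e^ε+1)/(e^ε-1))²·ln(2/δ)`.  Then for every integer `m` with
`γ·n ≤ m ≤ n`, the mechanism that on input `x ∈ {0,1}^m` outputs
`Σᵢ xᵢ + η` with `η ∼ Binomial(m, p)` is `(ε, 2·(δ/2)^γ)`-differentially
private: for `x, x'` differing in one coordinate and every `T ⊆ ℤ`,
`P(Σxᵢ + η ∈ T) ≤ e^ε·P(Σx'ᵢ + η ∈ T) + 2·(δ/2)^γ`. -/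
theorem stmt_16
    (ε γ δ : ℝ) (hε : 0 < ε) (hγ0 : 0 < γ) (hγ1 : γ ≤ 1)
    (hδ0 : 0 < δ) (hδ1 : δ < 1)
    (n : ℕ) (hn0 : 0 < n)
    (hn : 20 * ((Real.exp ε + 1) / (Real.exp ε - 1)) ^ 2 * Real.log (2 / δ)
      ≤ (n : ℝ))
    (p : ℝ)
    (hp : p = 1 - (10 / n) * ((Real.exp ε + 1) / (Real.exp ε - 1)) ^ 2
      * Real.log (2 / δ))
    (m : ℕ) (hm1 : γ * n ≤ (m : ℝ)) (hm2 : m ≤ n)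
    (x x' : Fin m → Fin 2) (hnb : ∃ i, ∀ j, j ≠ i → x j = x' j)
    (T : Set ℤ) :
    (∑ v ∈ Finset.range (m + 1),
        if ((∑ i, (x i : ℕ) : ℕ) + v : ℤ) ∈ T
        then (m.choose v : ℝ) * p ^ v * (1 - p) ^ (m - v) else 0)
      ≤ Real.exp ε *
        (∑ v ∈ Finset.range (m + 1),
          if ((∑ i, (x' i : ℕ) : ℕ) + v : ℤ) ∈ T
          then (m.choose v : ℝ) * p ^ v * (1 - p) ^ (m - v) else 0)
        + 2 * (δ / 2) ^ γ := by
  change (∑ v ∈ Finset.range (m + 1),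
      if ((∑ i, (x i : ℕ) : ℕ) + v : ℤ) ∈ T then binomialWeight m p v else 0)
    ≤ Real.exp ε * (∑ v ∈ Finset.range (m + 1),
      if ((∑ i, (x' i : ℕ) : ℕ) + v : ℤ) ∈ T then binomialWeight m p v else 0)
    + 2 * (δ / 2) ^ γ
  set a := Real.exp ε
  have ha : 1 < a := Real.one_lt_exp_iff.2 hε
  set K := (a + 1) / (a - 1) with hK
  set L := Real.log (2 / δ) with hL
  have hn' : (0 : ℝ) < n := by exact_mod_cast hn0
  have hL0 : 0 < L := Real.log_pos (by rw [lt_div_iff₀ hδ0]; linarith)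
  have hK1 : 1 < K := by rw [hK, lt_div_iff₀ (by linarith)]; linarith
  have hq : n * (1 - p) = 10 * K ^ 2 * L := by rw [hp]; field_simp; ring
  have hp1 : p < 1 := by
    have : 0 < (n : ℝ) * (1 - p) := by rw [hq]; positivity
    linarith [pos_of_mul_pos_right this hn'.le]
  have hp0 : 1 / 2 ≤ p := by
    have : (n : ℝ) * (1 - p) ≤ n * (1 / 2) := by linarith
    linarith [le_of_mul_le_mul_left this hn']
  have hf : ∀ v, 0 ≤ binomialWeight m p v :=
    binomialWeight_nonneg (by linarith) hp1.le m
  have hpow : (δ / 2) ^ γ = Real.exp (-(γ * L)) := by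
    rw [Real.rpow_def_of_pos (by positivity), hL, ← inv_div δ 2, Real.log_inv]
    congr 1
    ring
  have hpow0 : 0 < (δ / 2) ^ γ := Real.rpow_pos_of_pos (by positivity) _
  have hsum0 : ∀ S : ℕ → Prop,
      0 ≤ ∑ v ∈ Finset.range (m + 1), if S v then binomialWeight m p v else 0 := fun S =>
    Finset.sum_nonneg fun v _ => by split_ifs <;> simp [hf]
  have hsum1 : ∀ S : ℕ → Prop,
      ∑ v ∈ Finset.range (m + 1), (if S v then binomialWeight m p v else 0) ≤ 1 := fun S => by
    rw [← sum_binomialWeight m p]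
    exact Finset.sum_le_sum fun v _ => by split_ifs <;> simp [hf]
  rcases le_total 1 (2 * (δ / 2) ^ γ) with htriv | hsmall
  · have h1 := hsum1 fun v => ((∑ i, (x i : ℕ) : ℕ) + v : ℤ) ∈ T
    have h2 := mul_nonneg (zero_le_one.trans ha.le)
      (hsum0 fun v => ((∑ i, (x' i : ℕ) : ℕ) + v : ℤ) ∈ T)
    linarith
  have hγL : 1 / 2 ≤ γ * L := by
    have := Real.add_one_le_exp (-(γ * L))
    rw [hpow] at hsmall
    linarith
  have hμ : 10 * K ^ 2 * (γ * L) ≤ m * (1 - p) := by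
    have := mul_le_mul_of_nonneg_right hm1 (show 0 ≤ 1 - p by linarith)
    linear_combination this - γ * hq
  have hk : K⁻¹ * (a + 1) = a - 1 := by
    have : a - 1 ≠ 0 := by linarith
    rw [hK]; field_simp
  have hμ4 : 4 ≤ K⁻¹ * (m * (1 - p)) := by
    rw [inv_mul_eq_div, le_div_iff₀ (by linarith)]
    nlinarith [mul_le_mul_of_nonneg_left hγL (sq_nonneg K)]
  have hbound : Real.exp (-(m * (1 - p) * (9 / 64 * K⁻¹ ^ 2))) ≤ 2 * (δ / 2) ^ γ := by
    have hle : Real.exp (-(m * (1 - p) * (9 / 64 * K⁻¹ ^ 2))) ≤ (δ / 2) ^ γ := by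
      rw [hpow]
      refine Real.exp_le_exp.2 (neg_le_neg ?_)
      have h1 := mul_le_mul_of_nonneg_right hμ (show 0 ≤ 9 / 64 * K⁻¹ ^ 2 by positivity)
      have h2 : 10 * K ^ 2 * (γ * L) * (9 / 64 * K⁻¹ ^ 2) = 90 / 64 * (γ * L) := by
        field_simp
        ring
      linarith
    linarith
  have hcast : ∀ s v : ℕ, ((s + 1 : ℕ) : ℤ) + v = s + (v + 1 : ℕ) := by
    intros
    push_cast
    ring
  rcases sum_bits_neighbours hnb with h | h | h
  · rw [h]
    have h0 := hsum0 fun v => ((∑ i, (x' i : ℕ) : ℕ) + v : ℤ) ∈ T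
    linarith [le_mul_of_one_le_left h0 ha.le]
  · have := sum_ite_shift_right_le (zero_le_one.trans ha.le) hf (binomialWeight_self_succ m p)
      (fun v => ((∑ i, (x' i : ℕ) : ℕ) + v : ℤ) ∈ T)
      ((sum_binomialWeight_succ_drop_le ha hp0 hp1 hk hμ4).trans hbound)
    rw [h]
    simpa only [hcast] using this
  · have := sum_ite_shift_left_le (zero_le_one.trans ha.le) hf
      (fun v => ((∑ i, (x i : ℕ) : ℕ) + v : ℤ) ∈ T)
      ((sum_binomialWeight_pred_rise_le ha hp0 hp1 hk hμ4).trans hbound)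
    rw [h]
    simpa only [hcast] using this
end
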